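/- arXiv:1909.02247 — 2 statements merged into one kernel-verified Lean document; each statement's English description precedes it below -/
import Mathlib

section
/- Let M be the graph on six vertices w1,...,w6 consisting of the 6-cycle w1w2w3w4w5w6 together with the two chords w2w4 and w3w6. Let G be a finite simple graph that contains no induced subgraph isomorphic to 2K2 (the disjoint union of two edges) and no induced subgraph isomorphic to M. Then χ(G) ≤ ⌈(Δ(G) + ω(G) + 1)/2⌉. -/
open SimpleGraph

/-- `2K2`: the disjoint union of the two edges `0-1` and `2-3`. -/
def twoK2 : SimpleGraph (Fin 4) :=
  SimpleGraph.fromRel (fun a b => (a = 0 ∧ b = 1) ∨ (a = 2 ∧ b = 3))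

/-- The graph `M`: the 6-cycle `0-1-2-3-4-5-0` (for `w1 … w6`) together with the two
chords `w2w4 = 1-3` and `w3w6 = 2-5`. -/
def graphM : SimpleGraph (Fin 6) :=
  SimpleGraph.fromRel (fun a b =>
    (a = 0 ∧ b = 1) ∨ (a = 1 ∧ b = 2) ∨ (a = 2 ∧ b = 3) ∨
    (a = 3 ∧ b = 4) ∨ (a = 4 ∧ b = 5) ∨ (a = 5 ∧ b = 0) ∨
    (a = 1 ∧ b = 3) ∨ (a = 2 ∧ b = 5))

namespace SimpleGraph

variable {V : Type*} {G : SimpleGraph V}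

/-- `G` has no induced `2K2`, spelled out on adjacencies. -/
def TwoEdgesMeet (G : SimpleGraph V) : Prop :=
  ∀ a b c d, G.Adj a b → G.Adj c d → G.Adj a c ∨ G.Adj a d ∨ G.Adj b c ∨ G.Adj b d

/-- The vertices `p₀, …, p₄` form, in this cyclic order, an induced 5-cycle of the complement. -/
structure IsCoPentagon (G : SimpleGraph V) (p₀ p₁ p₂ p₃ p₄ : V) : Prop where
  adj02 : G.Adj p₀ p₂
  adj03 : G.Adj p₀ p₃
  adj13 : G.Adj p₁ p₃
  adj14 : G.Adj p₁ p₄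
  adj24 : G.Adj p₂ p₄
  not01 : ¬ G.Adj p₀ p₁
  not12 : ¬ G.Adj p₁ p₂
  not23 : ¬ G.Adj p₂ p₃
  not34 : ¬ G.Adj p₃ p₄
  not40 : ¬ G.Adj p₄ p₀

/-- No vertex misses exactly two consecutive vertices of a co-pentagon. Together with the absence
of an induced `2K2` this is the absence of an induced `M`. -/
def NoRoofedCoPentagon (G : SimpleGraph V) : Prop :=
  ∀ p₀ p₁ p₂ p₃ p₄ x, G.IsCoPentagon p₀ p₁ p₂ p₃ p₄ →
    ¬ G.Adj x p₀ → ¬ G.Adj x p₁ → G.Adj x p₂ → G.Adj x p₃ → G.Adj x p₄ → False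

theorem twoEdgesMeet_of_isEmpty (h : IsEmpty (twoK2 ↪g G)) : G.TwoEdgesMeet := by
  intro a b c d hab hcd
  by_contra! hn
  obtain ⟨hac, had, hbc, hbd⟩ := hn
  have key : ∀ i j : Fin 4, G.Adj (![a, b, c, d] i) (![a, b, c, d] j) ↔ twoK2.Adj i j := by
    intro i j
    fin_cases i <;> fin_cases j <;>
      simp [twoK2, hab, hcd, hac, had, hbc, hbd, G.adj_comm b a, G.adj_comm d c, G.adj_comm c a,
        G.adj_comm d a, G.adj_comm c b, G.adj_comm d b]
  refine h.elim ⟨⟨![a, b, c, d], fun i j hij => ?_⟩, key _ _⟩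
  have hk : ∀ k, twoK2.Adj i k ↔ twoK2.Adj j k := fun k => by rw [← key, ← key, hij]
  have h0 := hk 0
  have h1 := hk 1
  have h2 := hk 2
  have h3 := hk 3
  clear hk hij key
  revert h0 h1 h2 h3
  fin_cases i <;> fin_cases j <;> simp [twoK2]

theorem noRoofedCoPentagon_of_isEmpty (h : IsEmpty (graphM ↪g G)) : G.NoRoofedCoPentagon := by
  intro p₀ p₁ p₂ p₃ p₄ x ⟨h02, h03, h13, h14, h24, n01, n12, n23, n34, n40⟩ x0 x1 x2 x3 x4
  -- the vertices `w1, …, w6` of `M` are `p₀, p₂, x, p₄, p₁, p₃`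
  have key : ∀ i j : Fin 6,
      G.Adj (![p₀, p₂, x, p₄, p₁, p₃] i) (![p₀, p₂, x, p₄, p₁, p₃] j) ↔ graphM.Adj i j := by
    have n04 := n40
    have n10 := n01
    have n21 := n12
    have n32 := n23
    have n43 := n34
    rw [G.adj_comm] at n04 n10 n21 n32 n43
    have x0' := x0
    have x1' := x1
    rw [G.adj_comm] at x0' x1'
    intro i j
    fin_cases i <;> fin_cases j <;>
      simp [graphM, h02, h03, h13, h14, h24, h02.symm, h03.symm, h13.symm, h14.symm, h24.symm,
        n01, n12, n23, n34, n40, n04, n10, n21, n32, n43, x0, x1, x0', x1', x2, x3, x4,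
        x2.symm, x3.symm, x4.symm]
  refine h.elim ⟨⟨![p₀, p₂, x, p₄, p₁, p₃], fun i j hij => ?_⟩, key _ _⟩
  have hk : ∀ k, graphM.Adj i k ↔ graphM.Adj j k := fun k => by rw [← key, ← key, hij]
  have k0 := hk 0
  have k1 := hk 1
  have k2 := hk 2
  have k3 := hk 3
  have k4 := hk 4
  have k5 := hk 5
  clear hk hij key
  revert k0 k1 k2 k3 k4 k5
  fin_cases i <;> fin_cases j <;> simp [graphM]

namespace IsCoPentagon

variable {p₀ p₁ p₂ p₃ p₄ : V}

theorem rotate (h : G.IsCoPentagon p₀ p₁ p₂ p₃ p₄) : G.IsCoPentagon p₁ p₂ p₃ p₄ p₀ :=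
  ⟨h.adj13, h.adj14, h.adj24, h.adj02.symm, h.adj03.symm, h.not12, h.not23, h.not34, h.not40,
    h.not01⟩

theorem reflect (h : G.IsCoPentagon p₀ p₁ p₂ p₃ p₄) : G.IsCoPentagon p₀ p₄ p₃ p₂ p₁ :=
  ⟨h.adj03, h.adj02, h.adj24.symm, h.adj14.symm, h.adj13.symm, fun a => h.not40 a.symm,
    fun a => h.not34 a.symm, fun a => h.not23 a.symm, fun a => h.not12 a.symm,
    fun a => h.not01 a.symm⟩

theorem not_adj_between (h : G.IsCoPentagon p₀ p₁ p₂ p₃ p₄) (h2 : G.TwoEdgesMeet) {x : V}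
    (x0 : ¬ G.Adj x p₀) (x2 : ¬ G.Adj x p₂) : ¬ G.Adj x p₁ := by
  intro x1
  have := h2 x p₁ p₀ p₂ x1 h.adj02
  have := h.not01
  have := h.not12
  grind [G.adj_comm]

theorem not_adj_next (h : G.IsCoPentagon p₀ p₁ p₂ p₃ p₄) (h2 : G.TwoEdgesMeet)
    (hM : G.NoRoofedCoPentagon) {x : V}
    (x0 : ¬ G.Adj x p₀) (x1 : ¬ G.Adj x p₁) : ¬ G.Adj x p₄ ∨ ¬ G.Adj x p₂ := by
  by_contra! hn
  refine hM _ _ _ _ _ x h x0 x1 hn.2 ?_ hn.1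
  by_contra x3
  exact h.rotate.not_adj_between h2 x1 x3 hn.2

/-- The vertices missing two consecutive vertices of a co-pentagon form a stable set. -/
theorem stable (h : G.IsCoPentagon p₀ p₁ p₂ p₃ p₄) (h2 : G.TwoEdgesMeet)
    (hM : G.NoRoofedCoPentagon) {x y : V} (x0 : ¬ G.Adj x p₀) (x1 : ¬ G.Adj x p₁)
    (y0 : ¬ G.Adj y p₀) (y1 : ¬ G.Adj y p₁) : ¬ G.Adj x y := by
  -- the case in which the third missed vertices differ
  have mixed : ∀ {x y : V}, ¬ G.Adj x p₀ → ¬ G.Adj x p₁ → ¬ G.Adj y p₀ → ¬ G.Adj y p₁ →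
      ¬ G.Adj x p₄ → G.Adj x p₂ → G.Adj y p₄ → ¬ G.Adj y p₂ → ¬ G.Adj x y := by
    intro x y x0 x1 y0 y1 x4 x2 y4 y2 hxy
    have x3 : G.Adj x p₃ := by
      by_contra x3
      exact h.rotate.not_adj_between h2 x1 x3 x2
    have hp : G.IsCoPentagon x p₁ p₂ p₃ p₄ :=
      ⟨x2, x3, h.adj13, h.adj14, h.adj24, x1, h.not12, h.not23, h.not34, fun a => x4 a.symm⟩
    rcases hp.rotate.not_adj_next h2 hM y1 y2 with hy | hy
    · exact hy hxy.symm
    · exact h.rotate.rotate.rotate.not_adj_between h2 hy y0 y4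
  intro hxy
  have a := h2 x y p₀ p₂ hxy h.adj02
  have b := h2 x y p₄ p₁ hxy h.adj14.symm
  rcases h.not_adj_next h2 hM x0 x1 with hx | hx <;>
    rcases h.not_adj_next h2 hM y0 y1 with hy | hy
  · grind
  · by_cases G.Adj x p₂ <;> by_cases G.Adj y p₄ <;> grind
  · by_cases G.Adj y p₂ <;> by_cases G.Adj x p₄ <;> grind [G.adj_comm]
  · grind

/-- The first neighbour of `p₀` on a co-pentagon can be exchanged for any vertex with the same
adjacencies to the other four vertices. -/
theorem exchange (h : G.IsCoPentagon p₀ p₁ p₂ p₃ p₄) {x : V} (x0 : ¬ G.Adj x p₀)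
    (x2 : ¬ G.Adj x p₂) (x3 : G.Adj x p₃) (x4 : G.Adj x p₄) : G.IsCoPentagon p₀ x p₂ p₃ p₄ :=
  ⟨h.adj02, h.adj03, x3, x4, h.adj24, fun a => x0 a.symm, x2, h.not23, h.not34, h.not40⟩

/-- Two co-pentagons through `p₀`, the second one avoiding the vertices that miss `p₁, p₂` or
`p₃, p₄`. -/
theorem adj_of_disjoint (h : G.IsCoPentagon p₀ p₁ p₂ p₃ p₄) (h2 : G.TwoEdgesMeet)
    (hM : G.NoRoofedCoPentagon) {q r₂ r₃ r₄ : V} (hq : G.IsCoPentagon p₀ q r₂ r₃ r₄)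
    (q12 : G.Adj q p₁ ∨ G.Adj q p₂) (r12 : G.Adj r₄ p₁ ∨ G.Adj r₄ p₂)
    (r2 : G.Adj r₂ p₁ ∨ G.Adj r₂ p₂) (r34 : G.Adj r₄ p₃ ∨ G.Adj r₄ p₄) :
    G.Adj q p₁ := by
  by_contra q1
  have q0 : ¬ G.Adj q p₀ := fun a => hq.not01 a.symm
  have q2 : G.Adj q p₂ := by tauto
  have q4 : ¬ G.Adj q p₄ := by
    have := h.not_adj_next h2 hM q0 q1
    tauto
  have finish : G.Adj r₄ p₁ := by
    by_contra r1
    have r4 : ¬ G.Adj r₄ p₄ := by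
      have := h.not_adj_next h2 hM hq.not40 r1
      tauto
    exact h.rotate.rotate.rotate.rotate.stable h2 hM r4 hq.not40 q4 q0 hq.adj14.symm
  have p1 := hq.not_adj_next h2 hM (x := p₁) (fun a => h.not01 a.symm) (fun a => q1 a.symm)
  have p1r : ¬ G.Adj p₁ r₂ := p1.resolve_left (fun a => a finish.symm)
  have r2p2 : G.Adj r₂ p₂ := by grind [G.adj_comm]
  have r2p4 : G.Adj r₂ p₄ := by
    have := h.rotate.rotate.rotate.rotate.not_adj_between h2 (x := r₂)
    have := hq.adj02
    grind [G.adj_comm]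
  have p4 := hq.not_adj_next h2 hM (x := p₄) h.not40 (fun a => q4 a.symm)
  have p4r : ¬ G.Adj p₄ r₄ := p4.resolve_right (fun a => a r2p4.symm)
  have r3 : G.Adj r₄ p₃ := by grind [G.adj_comm]
  have := h.rotate.rotate.rotate.rotate.not_adj_next h2 hM (x := r₄)
    (fun a => p4r a.symm) hq.not40
  tauto

/-- If `q` is adjacent to `p₀` and misses `p₁`, then no further vertex outside the stable sets
given by `p₁, p₂` and `p₃, p₄` can miss both `p₀` and `q`. -/
theorem adj_of_not_adj (h : G.IsCoPentagon p₀ p₁ p₂ p₃ p₄) (h2 : G.TwoEdgesMeet)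
    (hM : G.NoRoofedCoPentagon) {q s : V} (q0 : G.Adj p₀ q) (q1 : ¬ G.Adj q p₁)
    (q12 : G.Adj q p₁ ∨ G.Adj q p₂) (s12 : G.Adj s p₁ ∨ G.Adj s p₂)
    (s34 : G.Adj s p₃ ∨ G.Adj s p₄) (s0 : ¬ G.Adj p₀ s) : G.Adj q s := by
  by_contra qs
  have s0' : ¬ G.Adj s p₀ := fun a => s0 a.symm
  have s1 : ¬ G.Adj s p₁ := by
    intro s1
    have := h2 p₀ q s p₁ q0 s1
    have := h.not01
    tauto
  have s2 : G.Adj s p₂ := by tauto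
  have s4 : ¬ G.Adj s p₄ := by
    have := h.not_adj_next h2 hM s0' s1
    tauto
  have s3 : G.Adj s p₃ := by tauto
  have q2 : G.Adj q p₂ := by tauto
  have q4 : G.Adj q p₄ := by
    by_contra q4
    exact h.rotate.rotate.rotate.rotate.not_adj_between h2 q4 q1 q0.symm
  have q3 : G.Adj q p₃ := by
    by_contra q3
    exact h.rotate.not_adj_between h2 q1 q3 q2
  have hp : G.IsCoPentagon s p₁ p₂ p₃ p₄ :=
    ⟨s2, s3, h.adj13, h.adj14, h.adj24, s1, h.not12, h.not23, h.not34, fun a => s4 a.symm⟩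
  exact hM _ _ _ _ _ q hp qs q1 q2 q3 q4

end IsCoPentagon

/-- `φ` is a proper colouring of the subgraph induced on `A` with colours in `K`. -/
def ProperOn (G : SimpleGraph V) (A : Finset V) (K : Finset ℕ) (φ : V → ℕ) : Prop :=
  (∀ x ∈ A, φ x ∈ K) ∧ ∀ x ∈ A, ∀ y ∈ A, G.Adj x y → φ x ≠ φ y

/-- `q` is the only neighbour of `v` in `A` with its colour. -/
def UniquelyColoured (G : SimpleGraph V) (A : Finset V) (φ : V → ℕ) (v q : V) : Prop :=
  G.Adj v q ∧ ∀ y ∈ A, φ y = φ q → G.Adj v y → y = q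

open Classical in
theorem two_mul_card_le_of_surjective (A : Finset V) (K : Finset ℕ) (φ : V → ℕ) (v : V)
    (hφ : ∀ x ∈ A, φ x ∈ K) (hs : ∀ k ∈ K, ∃ x ∈ A, G.Adj v x ∧ φ x = k) :
    2 * K.card ≤ (A.filter (G.UniquelyColoured A φ v)).card + (A.filter (G.Adj v)).card := by
  rw [Finset.card_eq_sum_card_fiberwise (f := φ) (t := K) (s := A.filter (G.UniquelyColoured A φ v))
      (fun x hx => hφ x (Finset.mem_filter.1 hx).1),
    Finset.card_eq_sum_card_fiberwise (f := φ) (t := K) (s := A.filter (G.Adj v))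
      (fun x hx => hφ x (Finset.mem_filter.1 hx).1), ← Finset.sum_add_distrib, mul_comm,
    ← smul_eq_mul]
  refine Finset.card_nsmul_le_sum _ _ _ fun k hk => ?_
  obtain ⟨x, hxA, hvx, rfl⟩ := hs k hk
  by_cases hu : G.UniquelyColoured A φ v x
  · have h1 : 0 < ((A.filter (G.UniquelyColoured A φ v)).filter (φ · = φ x)).card :=
      Finset.card_pos.2 ⟨x, by simp [hxA, hu]⟩
    have h2 : 0 < ((A.filter (G.Adj v)).filter (φ · = φ x)).card :=
      Finset.card_pos.2 ⟨x, by simp [hxA, hvx]⟩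
    omega
  · simp only [UniquelyColoured, hvx, true_and, not_forall] at hu
    obtain ⟨y, hyA, hyx, hvy, hne⟩ := hu
    have : 1 < ((A.filter (G.Adj v)).filter (φ · = φ x)).card :=
      Finset.one_lt_card.2 ⟨y, by simp [hyA, hvy, hyx], x, by simp [hxA, hvx], hne⟩
    omega

/-- A Kempe change: a uniquely coloured neighbour of an uncolourable vertex has neighbours in
every other colour. -/
theorem exists_adj_of_colour [DecidableEq V] {A : Finset V} {K : Finset ℕ} {φ : V → ℕ} {v a b : V}
    (hφ : G.ProperOn A K φ) (hn : ∀ ψ, ¬ G.ProperOn (insert v A) K ψ)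
    (ha : a ∈ A) (hb : b ∈ A) (hua : G.UniquelyColoured A φ v a) (hc : φ a ≠ φ b) :
    ∃ b' ∈ A, φ b' = φ b ∧ G.Adj a b' := by
  by_contra! hno
  obtain ⟨hK, hp⟩ := hφ
  obtain ⟨hva, hu⟩ := hua
  refine hn (fun x => if x = v then φ a else if x = a then φ b else φ x) ⟨?_, ?_⟩
  · intro x hx
    have := hK x
    have := hK a ha
    have := hK b hb
    grind
  · intro x hx y hy hxy
    have := hp x
    have := hu x
    have := hu y
    have := hno x
    have := hno y
    have := G.ne_of_adj hxy
    have := hxy.symm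
    grind

/-- Two non-adjacent uniquely coloured neighbours of an uncolourable vertex lie with it on a
co-pentagon whose other two vertices repeat their colours. -/
theorem exists_isCoPentagon [DecidableEq V] (h2 : G.TwoEdgesMeet) {A : Finset V} {K : Finset ℕ}
    {φ : V → ℕ} {v a b : V} (hφ : G.ProperOn A K φ) (hn : ∀ ψ, ¬ G.ProperOn (insert v A) K ψ)
    (ha : a ∈ A) (hb : b ∈ A) (hua : G.UniquelyColoured A φ v a)
    (hub : G.UniquelyColoured A φ v b) (hne : a ≠ b) (hab : ¬ G.Adj a b) :
    φ a ≠ φ b ∧ ∃ a' ∈ A, ∃ b' ∈ A, φ a' = φ a ∧ φ b' = φ b ∧ G.IsCoPentagon v b' b a a' := by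
  have hc : φ a ≠ φ b := fun h => hne (hub.2 a ha h hua.1)
  obtain ⟨b', hb', hbc, hab'⟩ := exists_adj_of_colour hφ hn ha hb hua hc
  obtain ⟨a', ha', hac, hba'⟩ := exists_adj_of_colour hφ hn hb ha hub hc.symm
  have hvb' : ¬ G.Adj v b' := fun h => hab (hub.2 b' hb' hbc h ▸ hab')
  have hva' : ¬ G.Adj v a' := fun h => hab (hua.2 a' ha' hac h ▸ hba').symm
  have haa' : ¬ G.Adj a a' := fun h => hφ.2 a ha a' ha' h hac.symm
  have hbb' : ¬ G.Adj b' b := fun h => hφ.2 b' hb' b hb h hbc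
  refine ⟨hc, a', ha', b', hb', hac, hbc, hub.1, hua.1, hab'.symm, ?_, hba', hvb', hbb',
    fun h => hab h.symm, haa', fun h => hva' h.symm⟩
  have := h2 a b' b a' hab' hba'
  grind

/-- The vertex `p₁` of a co-pentagon through an uncolourable vertex `p₀` can be exchanged so that
it becomes adjacent to all uniquely coloured neighbours of `p₀` that remain when the stable sets
given by `p₁, p₂` and `p₃, p₄` are removed along with two colours. -/
theorem IsCoPentagon.exists_replacement [DecidableEq V] {p₀ p₁ p₂ p₃ p₄ : V}
    (h : G.IsCoPentagon p₀ p₁ p₂ p₃ p₄) (h2 : G.TwoEdgesMeet) (hM : G.NoRoofedCoPentagon)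
    {A A' : Finset V} {K K' : Finset ℕ} {φ : V → ℕ} {α β : ℕ}
    (hn : ∀ ψ, ¬ G.ProperOn (insert p₀ A) K ψ) (hφ : G.ProperOn A' K' φ)
    (hA' : ∀ x, x ∈ A' ↔ x ∈ A ∧ (G.Adj x p₁ ∨ G.Adj x p₂) ∧ (G.Adj x p₃ ∨ G.Adj x p₄))
    (hK : K' ⊆ K) (hα : α ∈ K) (hβ : β ∈ K) (hα' : α ∉ K') (hβ' : β ∉ K') (hαβ : α ≠ β) :
    ∃ t ∈ A, ¬ G.Adj t p₀ ∧ ¬ G.Adj t p₁ ∧ ¬ G.Adj t p₂ ∧ G.Adj t p₃ ∧ G.Adj t p₄ ∧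
      ∀ q ∈ A', G.UniquelyColoured A' φ p₀ q → G.Adj q t := by
  classical
  by_contra! hno
  choose! f hfA hfu hft using hno
  let ψ : V → ℕ := fun x => if ¬ G.Adj x p₄ ∧ ¬ G.Adj x p₀ then α else
    if ¬ G.Adj x p₂ ∧ ¬ G.Adj x p₃ then β else
    if ¬ G.Adj x p₁ ∧ ¬ G.Adj x p₂ then φ (f x) else φ x
  have hψ : ∀ x ∈ insert p₀ A, (¬ G.Adj x p₄ ∧ ¬ G.Adj x p₀ ∧ ψ x = α) ∨
      (¬ G.Adj x p₂ ∧ ¬ G.Adj x p₃ ∧ ψ x = β) ∨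
      (x ∈ A ∧ ¬ G.Adj x p₀ ∧ ¬ G.Adj x p₁ ∧ ¬ G.Adj x p₂ ∧ G.Adj x p₃ ∧ G.Adj x p₄ ∧
        ψ x = φ (f x)) ∨ (x ∈ A' ∧ ψ x = φ x) := by
    intro x hx
    by_cases c40 : ¬ G.Adj x p₄ ∧ ¬ G.Adj x p₀
    · exact .inl ⟨c40.1, c40.2, by simp [ψ, c40]⟩
    by_cases c23 : ¬ G.Adj x p₂ ∧ ¬ G.Adj x p₃
    · exact .inr (.inl ⟨c23.1, c23.2, by simp only [ψ, if_neg c40, if_pos c23]⟩)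
    have hxA : x ∈ A := by
      rcases Finset.mem_insert.1 hx with rfl | hx
      · exact (c40 ⟨fun a => h.not40 a.symm, G.irrefl⟩).elim
      · exact hx
    by_cases c12 : ¬ G.Adj x p₁ ∧ ¬ G.Adj x p₂
    · have := h.rotate.not_adj_next h2 hM c12.1 c12.2
      exact .inr (.inr (.inl ⟨hxA, by tauto, c12.1, c12.2, by tauto, by tauto,
        by simp only [ψ, if_neg c40, if_neg c23, if_pos c12]⟩))
    · refine .inr (.inr (.inr ⟨(hA' x).2 ⟨hxA, by tauto, ?_⟩,
        by simp only [ψ, if_neg c40, if_neg c23, if_neg c12]⟩))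
      by_contra! c34
      have := h.rotate.rotate.rotate.not_adj_next h2 hM c34.1 c34.2
      tauto
  clear_value ψ
  have mixed : ∀ x y, x ∈ A → ¬ G.Adj x p₀ → ¬ G.Adj x p₁ → ¬ G.Adj x p₂ → G.Adj x p₃ →
      G.Adj x p₄ → y ∈ A' → φ (f x) = φ y → ¬ G.Adj x y := by
    intro x y hx x0 x1 x2 x3 x4 hy hc hxy
    have hq := hfA x hx x0 x1 x2 x3 x4
    have hu := hfu x hx x0 x1 x2 x3 x4
    have hqx := hft x hx x0 x1 x2 x3 x4
    have hp := h.exchange x0 x2 x3 x4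
    have meets : ∀ z ∈ A', G.Adj z x ∨ G.Adj z p₂ := by
      intro z hz
      by_contra! hz'
      have := hp.rotate.stable h2 hM hz'.1 hz'.2 (fun a => x1 a.symm) h.not12
      have := ((hA' z).1 hz).2.1
      tauto
    by_cases hyq : y = f x
    · exact hqx (hyq ▸ hxy.symm)
    · exact hφ.2 _ hq _ hy (hp.adj_of_not_adj h2 hM hu.1 hqx (meets _ hq) (meets _ hy)
        ((hA' y).1 hy).2.2 (fun a => hyq (hu.2 y hy hc.symm a))) hc
  refine hn ψ ⟨fun x hx => ?_, fun x hx y hy hxy hc => ?_⟩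
  · rcases hψ x hx with ⟨-, -, e⟩ | ⟨-, -, e⟩ | ⟨hxA, x0, x1, x2, x3, x4, e⟩ | ⟨hxA, e⟩
    · exact e ▸ hα
    · exact e ▸ hβ
    · exact e ▸ hK (hφ.1 _ (hfA x hxA x0 x1 x2 x3 x4))
    · exact e ▸ hK (hφ.1 _ hxA)
  · have old : ∀ z ∈ A', φ z ≠ α ∧ φ z ≠ β := fun z hz =>
      ⟨fun e => hα' (e ▸ hφ.1 z hz), fun e => hβ' (e ▸ hφ.1 z hz)⟩
    rcases hψ x hx with ⟨x4, x0, e⟩ | ⟨x2, x3, e⟩ | ⟨hxA, x0, x1, x2, x3, x4, e⟩ | ⟨hxA, e⟩ <;>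
      rcases hψ y hy with ⟨y4, y0, ey⟩ | ⟨y2, y3, ey⟩ | ⟨hyA, y0, y1, y2, y3, y4, ey⟩ | ⟨hyA, ey⟩
    · exact h.rotate.rotate.rotate.rotate.stable h2 hM x4 x0 y4 y0 hxy
    · grind
    · have := old _ (hfA y hyA y0 y1 y2 y3 y4)
      grind
    · grind
    · grind
    · exact h.rotate.rotate.stable h2 hM x2 x3 y2 y3 hxy
    · have := old _ (hfA y hyA y0 y1 y2 y3 y4)
      grind
    · grind
    · have := old _ (hfA x hxA x0 x1 x2 x3 x4)
      grind
    · have := old _ (hfA x hxA x0 x1 x2 x3 x4)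
      grind
    · exact h.rotate.stable h2 hM x1 x2 y1 y2 hxy
    · exact mixed x y hxA x0 x1 x2 x3 x4 hyA (by rw [← e, hc, ey]) hxy
    · grind
    · grind
    · exact mixed y x hyA y0 y1 y2 y3 y4 hxA (by rw [← ey, ← hc, e]) hxy.symm
    · exact hφ.2 x hxA y hyA hxy (by rw [← e, hc, ey])

/-- In an uncolourable graph `insert v A` with `A` colourable, the neighbours of `v` of unique
colour can be traded for a clique of at least the same size. -/
theorem exists_large_clique [DecidableEq V] [DecidableRel G.Adj] (h2 : G.TwoEdgesMeet)
    (hM : G.NoRoofedCoPentagon) (v : V) (A : Finset V) :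
    ∀ (K : Finset ℕ) (φ₀ : V → ℕ), G.ProperOn A K φ₀ → (∀ ψ, ¬ G.ProperOn (insert v A) K ψ) →
      ∃ (φ : V → ℕ) (Q : Finset V), G.ProperOn A K φ ∧ Q ⊆ A ∧ G.IsClique (Q : Set V) ∧
        2 * K.card ≤ Q.card + (A.filter (G.Adj v)).card ∧
        ∀ q ∈ Q, G.UniquelyColoured A φ v q ∨
          ∃ r₂ ∈ A, ∃ r₃ ∈ A, ∃ r₄ ∈ A, G.IsCoPentagon v q r₂ r₃ r₄ := by
  classical
  induction A using Finset.strongInduction with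
  | H A ih =>
  intro K φ₀ hφ₀ hn
  by_cases hcl : G.IsClique (A.filter (G.UniquelyColoured A φ₀ v) : Set V)
  · refine ⟨φ₀, A.filter (G.UniquelyColoured A φ₀ v), hφ₀, Finset.filter_subset _ _, hcl, ?_,
      fun q hq => .inl (Finset.mem_filter.1 hq).2⟩
    convert two_mul_card_le_of_surjective A K φ₀ v hφ₀.1 fun k hk => ?_
    by_contra! hno
    refine hn (fun x => if x = v then k else φ₀ x) ⟨fun x hx => ?_, fun x hx y hy hxy => ?_⟩
    · have := hφ₀.1 x
      grind
    · have := hφ₀.2 x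
      have := hno x
      have := hno y
      have := G.ne_of_adj hxy
      have := hxy.symm
      grind
  obtain ⟨a, ha, b, hb, hne, hab⟩ : ∃ a ∈ A.filter (G.UniquelyColoured A φ₀ v),
      ∃ b ∈ A.filter (G.UniquelyColoured A φ₀ v), a ≠ b ∧ ¬ G.Adj a b := by
    simpa [IsClique, Set.Pairwise, and_assoc] using hcl
  obtain ⟨ha, hua⟩ := Finset.mem_filter.1 ha
  obtain ⟨hb, hub⟩ := Finset.mem_filter.1 hb
  obtain ⟨hc, a', ha', b', hb', hac, hbc, hp⟩ :=
    exists_isCoPentagon h2 hφ₀ hn ha hb hua hub hne hab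
  let A' := A.filter fun x => (G.Adj x b' ∨ G.Adj x b) ∧ (G.Adj x a ∨ G.Adj x a')
  have hA' : ∀ x, x ∈ A' ↔ x ∈ A ∧ (G.Adj x b' ∨ G.Adj x b) ∧ (G.Adj x a ∨ G.Adj x a') := by
    simp [A']
  clear_value A'
  let K' := (K.erase (φ₀ a)).erase (φ₀ b)
  have hK' : ∀ k, k ∈ K' ↔ k ≠ φ₀ b ∧ k ≠ φ₀ a ∧ k ∈ K := by simp [K']
  have hKcard : K'.card + 2 = K.card := by
    have h1 := Finset.card_erase_add_one (hφ₀.1 a ha)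
    have h2 : K'.card + 1 = _ :=
      Finset.card_erase_add_one (Finset.mem_erase.2 ⟨hc.symm, hφ₀.1 b hb⟩)
    omega
  clear_value K'
  have extend : ∀ (B B' : Finset V) (φ : V → ℕ), (∀ x ∈ B', x ∈ B ∨
      (¬ G.Adj x b' ∧ ¬ G.Adj x b) ∨ (¬ G.Adj x a ∧ ¬ G.Adj x a')) → G.ProperOn B K' φ →
      G.ProperOn B' K (fun x => if ¬ G.Adj x b' ∧ ¬ G.Adj x b then φ₀ b else
        if ¬ G.Adj x a ∧ ¬ G.Adj x a' then φ₀ a else φ x) := by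
    intro B B' φ hB hφ
    refine ⟨fun x hx => ?_, fun x hx y hy hxy => ?_⟩
    · have := hφ.1 x
      have := hB x hx
      have := hφ₀.1 a ha
      have := hφ₀.1 b hb
      grind
    · have := hφ.1 x
      have := hφ.1 y
      have := hφ.2 x
      have := hB x hx
      have := hB y hy
      have := hp.rotate.stable h2 hM (x := x) (y := y)
      have := hp.rotate.rotate.rotate.stable h2 hM (x := x) (y := y)
      grind
  have cover : ∀ x ∈ A, x ∈ A' ∨ (¬ G.Adj x b' ∧ ¬ G.Adj x b) ∨ (¬ G.Adj x a ∧ ¬ G.Adj x a') := by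
    intro x hx
    have := hA' x
    tauto
  have hn' : ∀ ψ, ¬ G.ProperOn (insert v A') K' ψ := fun ψ hψ =>
    hn _ (extend (insert v A') (insert v A) ψ (fun x hx => by
      have := cover x
      grind) hψ)
  have hφ₀' : G.ProperOn A' K' φ₀ := by
    refine ⟨fun x hx => ?_, fun x hx y hy => hφ₀.2 x ((hA' x).1 hx).1 y ((hA' y).1 hy).1⟩
    obtain ⟨hxA, h12, h34⟩ := (hA' x).1 hx
    have := hφ₀.2 x hxA a ha
    have := hφ₀.2 x hxA b hb
    have := hφ₀.2 x hxA a' ha'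
    have := hφ₀.2 x hxA b' hb'
    have := hφ₀.1 x hxA
    grind
  have hsub : A' ⊆ A := fun x hx => ((hA' x).1 hx).1
  have hb'A' : b' ∉ A' := fun h => by
    have := (hA' b').1 h
    have := hp.not12
    have := G.irrefl (v := b')
    tauto
  obtain ⟨φ, Q, hφ, hQA, hQ, hcard, hQv⟩ :=
    ih A' (Finset.ssubset_iff_subset_ne.2 ⟨hsub, fun e => hb'A' (e ▸ hb')⟩) K' φ₀ hφ₀' hn'
  have hKsub : K' ⊆ K := fun k hk => ((hK' k).1 hk).2.2
  have haK : φ₀ a ∉ K' := fun h => ((hK' _).1 h).2.1 rfl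
  have hbK : φ₀ b ∉ K' := fun h => ((hK' _).1 h).1 rfl
  obtain ⟨t, htA, t0, t1, t2, t3, t4, ht⟩ := hp.exists_replacement h2 hM hn hφ hA' hKsub
    (hφ₀.1 a ha) (hφ₀.1 b hb) haK hbK hc
  obtain ⟨s, hsA, s0, s4, s3, s2, s1, hs⟩ := hp.reflect.exists_replacement h2 hM hn hφ
    (fun x => by rw [hA', and_comm (a := G.Adj x b' ∨ G.Adj x b), or_comm (a := G.Adj x b'),
      or_comm (a := G.Adj x a)]) hKsub (hφ₀.1 a ha) (hφ₀.1 b hb) haK hbK hc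
  have hst : G.Adj t s := by
    have := h2 t a b s t3 s2.symm
    have := hp.not23
    grind [G.adj_comm]
  have hpt := hp.exchange t0 t2 t3 t4
  have hps := hp.reflect.exchange s0 s3 s2 s1
  have hpts := (hpt.reflect.exchange s0 s3 s2 hst.symm).reflect
  have meets : ∀ z ∈ A', (G.Adj z t ∨ G.Adj z b) ∧ (G.Adj z a ∨ G.Adj z s) := by
    intro z hz
    have := (hA' z).1 hz
    constructor
    · by_contra! hz'
      have := hpt.rotate.stable h2 hM hz'.1 hz'.2 (fun a => t1 a.symm) hp.not12
      tauto
    · by_contra! hz'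
      have := hps.rotate.stable h2 hM hz'.2 hz'.1 (fun a => s4 a.symm) (fun a => hp.not34 a.symm)
      tauto
  have tA' : t ∉ A' := fun h => by
    have := (hA' t).1 h
    tauto
  have sA' : s ∉ A' := fun h => by
    have := (hA' s).1 h
    tauto
  have hQts : ∀ q ∈ Q, G.Adj q t ∧ G.Adj q s := by
    intro q hq
    rcases hQv q hq with hu | ⟨r₂, hr₂, r₃, -, r₄, hr₄, hr⟩
    · exact ⟨ht q (hQA hq) hu, hs q (hQA hq) hu⟩
    · have mq := meets q (hQA hq)
      have m2 := meets r₂ hr₂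
      have m4 := meets r₄ hr₄
      exact ⟨hpts.adj_of_disjoint h2 hM hr mq.1 m4.1 m2.1 m4.2,
        hpts.reflect.adj_of_disjoint h2 hM hr mq.2.symm m4.2.symm m2.2.symm m4.1.symm⟩
  refine ⟨_, insert t (insert s Q), extend A' A φ cover hφ, ?_, ?_, ?_, ?_⟩
  · exact Finset.insert_subset htA (Finset.insert_subset hsA (hQA.trans hsub))
  · rw [Finset.coe_insert, Finset.coe_insert, isClique_insert, isClique_insert]
    refine ⟨⟨hQ, fun q hq _ => (hQts q hq).2.symm⟩, ?_⟩
    rintro q (rfl | hq) -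
    · exact hst
    · exact (hQts q hq).1.symm
  · have hsQ : s ∉ Q := fun h => sA' (hQA h)
    have htQ : t ∉ insert s Q := fun h =>
      (Finset.mem_insert.1 h).elim (G.ne_of_adj hst) fun h => tA' (hQA h)
    have hN : (A'.filter (G.Adj v)).card + 2 ≤ (A.filter (G.Adj v)).card := by
      have hsubN : insert a (insert b (A'.filter (G.Adj v))) ⊆ A.filter (G.Adj v) := by
        simp only [Finset.insert_subset_iff, Finset.mem_filter]
        exact ⟨⟨ha, hua.1⟩, ⟨hb, hub.1⟩, Finset.filter_subset_filter _ hsub⟩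
      have hbN : b ∉ A'.filter (G.Adj v) := fun h => by
        have := ((hA' b).1 (Finset.mem_filter.1 h).1).2.1
        exact this.elim (fun e => hp.not12 e.symm) G.irrefl
      have haN : a ∉ insert b (A'.filter (G.Adj v)) := fun h => by
        have hmem := Finset.mem_filter.1 ((Finset.mem_insert.1 h).resolve_left hne)
        exact ((hA' a).1 hmem.1).2.2.elim G.irrefl hp.not34
      have := Finset.card_le_card hsubN
      rwa [Finset.card_insert_of_notMem haN, Finset.card_insert_of_notMem hbN] at this
    rw [Finset.card_insert_of_notMem htQ, Finset.card_insert_of_notMem hsQ]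
    omega
  · intro q hq
    rcases Finset.mem_insert.1 hq with rfl | hq
    · exact .inr ⟨b, hb, a, ha, a', ha', hpt⟩
    rcases Finset.mem_insert.1 hq with rfl | hq
    · exact .inr ⟨a, ha, b, hb, b', hb', hps⟩
    rcases hQv q hq with hu | ⟨r₂, hr₂, r₃, hr₃, r₄, hr₄, hr⟩
    · refine .inl ⟨hu.1, fun y hy hc hvy => ?_⟩
      have := (hA' q).1 (hQA hq)
      have := (hK' _).1 (hφ.1 q (hQA hq))
      have := cover y hy
      have := hu.2 y
      grind
    · exact .inr ⟨r₂, hsub hr₂, r₃, hsub hr₃, r₄, hsub hr₄, hr⟩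

/-- Every vertex set can be coloured with half of `Δ + ω + 1` colours, rounded up. -/
theorem exists_properOn [Fintype V] [DecidableEq V] [DecidableRel G.Adj] (h2 : G.TwoEdgesMeet)
    (hM : G.NoRoofedCoPentagon) (K : Finset ℕ) (hK : G.maxDegree + G.cliqueNum + 1 ≤ 2 * K.card)
    (A : Finset V) : ∃ φ, G.ProperOn A K φ := by
  induction A using Finset.induction with
  | empty => exact ⟨fun _ => 0, by simp [ProperOn]⟩
  | insert v A _ ih =>
    obtain ⟨φ₀, hφ₀⟩ := ih
    by_contra! hn
    obtain ⟨-, Q, -, -, hQ, hcard, -⟩ := exists_large_clique h2 hM v A K φ₀ hφ₀ hn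
    have hω : Q.card ≤ G.cliqueNum := hQ.card_le_cliqueNum
    have hΔ : (A.filter (G.Adj v)).card ≤ G.maxDegree := by
      refine le_trans (Finset.card_le_card fun x hx => ?_) (G.degree_le_maxDegree v)
      simpa using (Finset.mem_filter.1 hx).2
    omega

end SimpleGraph

/-- Reed's conjecture holds for `{2K2, M}`-free graphs. -/
theorem reed_twoK2_M_free {V : Type*} [Fintype V] (G : SimpleGraph V)
    [DecidableRel G.Adj]
    (h1 : IsEmpty (twoK2 ↪g G)) (h2 : IsEmpty (graphM ↪g G)) :
    G.chromaticNumber ≤ (((G.maxDegree + G.cliqueNum + 1) ⌈/⌉ 2 : ℕ) : ℕ∞) := by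
  classical
  obtain ⟨φ, hφ, hp⟩ := exists_properOn (twoEdgesMeet_of_isEmpty h1)
    (noRoofedCoPentagon_of_isEmpty h2)
    (Finset.range ((G.maxDegree + G.cliqueNum + 1) ⌈/⌉ 2))
    (by rw [Finset.card_range, Nat.ceilDiv_eq_add_pred_div]; omega) Finset.univ
  refine Colorable.chromaticNumber_le ⟨Coloring.mk
    (fun x => ⟨φ x, Finset.mem_range.1 (hφ x (Finset.mem_univ x))⟩) fun {x y} hxy e => ?_⟩
  exact hp x (Finset.mem_univ x) y (Finset.mem_univ y) hxy (Fin.mk.inj e)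
end

section
/- Let G be a finite simple graph with χ(G) > ⌈(Δ(G) + ω(G) + 1)/2⌉ such that every proper nonempty induced subgraph G' of G satisfies χ(G') ≤ ⌈(Δ(G') + ω(G') + 1)/2⌉. Let u be any vertex of G and let c be any proper coloring of G − u using exactly χ(G) − 1 colors. Then the number r of colors that appear on exactly one vertex of the neighborhood N(u) satisfies r ≥ ω(G) + 1. -/
open SimpleGraph

namespace SimpleGraph

variable {V : Type*} (G : SimpleGraph V)

/-- If a coloring of `G - u` misses a color on the neighborhood of `u`, it extends to `G`. -/
theorem colorable_of_forall_adj_ne {n : ℕ} (u : V) (C : (G.induce {u}ᶜ).Coloring (Fin n))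
    (c : Fin n) (hc : ∀ v : ({u}ᶜ : Set V), G.Adj u v → C v ≠ c) : G.Colorable n := by
  classical
  refine ⟨Coloring.mk (fun v => if h : v = u then c else C ⟨v, h⟩) ?_⟩
  intro v w hvw
  by_cases hv : v = u
  · subst hv
    have hw : w ≠ v := hvw.ne'
    simpa [hw] using (hc ⟨w, hw⟩ hvw).symm
  · by_cases hw : w = u
    · subst hw
      simpa [hv] using hc ⟨v, hv⟩ hvw.symm
    · simpa [hv, hw] using C.valid (v := ⟨v, hv⟩) (w := ⟨w, hw⟩) hvw

/-- If every color of a coloring of `G - u` appears in the neighborhood of `u`, then all but the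
colors appearing exactly once there contribute at least two to the degree of `u`. -/
theorem two_mul_le_degree_add_card_unique {n : ℕ} (u : V) [Fintype V] [DecidableRel G.Adj]
    (C : ({u}ᶜ : Set V) → Fin n) (hC : ∀ c, ∃ v : ({u}ᶜ : Set V), G.Adj u v ∧ C v = c) :
    2 * n ≤ G.degree u +
      Nat.card {c : Fin n // ∃! v : ({u}ᶜ : Set V), G.Adj u v ∧ C v = c} := by
  classical
  let S : Finset ({u}ᶜ : Set V) := {v | G.Adj u v}
  have hS : S.card ≤ G.degree u :=
    Finset.card_le_card_of_injOn (t := G.neighborFinset u) (fun v => (v : V))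
      (fun v hv => by simpa [S] using hv) Subtype.val_injective.injOn
  have hsum : S.card = ∑ c : Fin n, (S.filter (C · = c)).card :=
    Finset.card_eq_sum_card_fiberwise (fun _ _ => Finset.mem_coe.2 (Finset.mem_univ _))
  rw [Nat.card_eq_fintype_card, Fintype.card_subtype, Finset.card_filter]
  refine le_trans ?_ (Nat.add_le_add_right hS _)
  rw [hsum, ← Finset.sum_add_distrib]
  have key : ∀ c ∈ (Finset.univ : Finset (Fin n)), 2 ≤ (S.filter (C · = c)).card +
      if ∃! v : ({u}ᶜ : Set V), G.Adj u v ∧ C v = c then 1 else 0 := by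
    intro c _
    obtain ⟨v, hv, hvc⟩ := hC c
    have hmem : v ∈ S.filter (C · = c) := by simp [S, hv, hvc]
    have hpos := Finset.card_pos.2 ⟨v, hmem⟩
    split_ifs with h
    · lia
    · have hne : (S.filter (C · = c)).card ≠ 1 := by
        intro h1
        obtain ⟨w, hw⟩ := Finset.card_eq_one.1 h1
        refine h ⟨v, ⟨hv, hvc⟩, fun x hx => ?_⟩
        have hx' : x ∈ S.filter (C · = c) := by simp [S, hx.1, hx.2]
        rw [hw, Finset.mem_singleton] at hmem hx'
        rw [hx', hmem]
      lia
  simpa [mul_comm] using Finset.card_nsmul_le_sum _ _ _ key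

end SimpleGraph

/-- Let `G` violate Reed's bound `χ ≤ ⌈(Δ + ω + 1)/2⌉` while every proper nonempty
induced subgraph of `G` satisfies it.  Let `u` be a vertex of `G` and let `C` be a proper
coloring of `G − u` using exactly `χ(G) − 1` colors.  Then the number `r` of colors
appearing on exactly one vertex of the neighborhood `N(u)` satisfies `r ≥ ω(G) + 1`. -/
theorem minimal_counterexample_unique_colors {V : Type*} [Fintype V] [DecidableEq V]
    (G : SimpleGraph V) [DecidableRel G.Adj]
    (hG : (((G.maxDegree + G.cliqueNum + 1) ⌈/⌉ 2 : ℕ) : ℕ∞) < G.chromaticNumber)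
    (hmin : ∀ (s : Set V) [DecidablePred (· ∈ s)], s.Nonempty → s ≠ Set.univ →
      (G.induce s).chromaticNumber ≤
        ((((G.induce s).maxDegree + (G.induce s).cliqueNum + 1) ⌈/⌉ 2 : ℕ) : ℕ∞))
    (u : V) (n : ℕ) (hn : (n : ℕ∞) = G.chromaticNumber - 1)
    (C : (G.induce {u}ᶜ).Coloring (Fin n)) (hC : Function.Surjective C) :
    G.cliqueNum + 1 ≤
      Nat.card {c : Fin n // ∃! v : ({u}ᶜ : Set V), G.Adj u ↑v ∧ C v = c} := by
  obtain ⟨k, hk⟩ := ENat.ne_top_iff_exists.1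
    (chromaticNumber_ne_top_iff_exists.2 ⟨_, G.colorable_of_fintype⟩)
  rw [← hk, Nat.cast_lt, Nat.ceilDiv_eq_add_pred_div] at hG
  have hnk : n = k - 1 := by
    rw [← hk] at hn
    exact_mod_cast hn
  have hcolors : ∀ c, ∃ v : ({u}ᶜ : Set V), G.Adj u v ∧ C v = c := by
    intro c
    by_contra! hc
    have hle := (G.colorable_of_forall_adj_ne u C c hc).chromaticNumber_le
    rw [← hk, Nat.cast_le] at hle
    lia
  have hcount := G.two_mul_le_degree_add_card_unique u C hcolors
  have hdeg := G.degree_le_maxDegree u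
  lia
end
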